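/- arXiv:2009.12875 — 7 statements merged into one kernel-verified Lean document; each statement's English description precedes it below -/
import Mathlib

section
/- Theorem 1 (attainment of the global minimum). Assume d_H ≥ r = rank(X). Let D ∈ ℝ^{r×r} be the diagonal matrix with entries D_ii = sqrt(λ(1 − λ(σ_i^{−2} + λ)^{−1})) and let R ∈ ℝ^{d_H×r} be any matrix with orthonormal columns (RᵀR = I_r). Then W* = R D Uᵀ is a global minimizer of the siamese objective: g(W*) ≤ g(W) for every W ∈ ℝ^{d_H×d_X}. -/
open Matrix BigOperators

/-- Squared Frobenius norm of a real matrix. -/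
noncomputable def frobSq {m n : ℕ} (M : Matrix (Fin m) (Fin n) ℝ) : ℝ :=
  ∑ i, ∑ j, (M i j) ^ 2

/-- EDSC objective `f(C) = (1/2)‖C‖_F² + (λ/2)‖X − XC‖_F²`. -/
noncomputable def edsc {dX N : ℕ} (X : Matrix (Fin dX) (Fin N) ℝ) (lam : ℝ)
    (C : Matrix (Fin N) (Fin N) ℝ) : ℝ :=
  (1 / 2) * frobSq C + (lam / 2) * frobSq (X - X * C)

/-- Siamese objective `g(W) = f(XᵀWᵀWX)`. -/
noncomputable def siam {dX N dH : ℕ} (X : Matrix (Fin dX) (Fin N) ℝ) (lam : ℝ)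
    (W : Matrix (Fin dH) (Fin dX) ℝ) : ℝ :=
  edsc X lam (Xᵀ * Wᵀ * W * X)

theorem frobSq_nonneg {m n : ℕ} (M : Matrix (Fin m) (Fin n) ℝ) : 0 ≤ frobSq M :=
  Finset.sum_nonneg fun _ _ => Finset.sum_nonneg fun _ _ => sq_nonneg _

theorem frobSq_eq_trace {m n : ℕ} (M : Matrix (Fin m) (Fin n) ℝ) :
    frobSq M = (Mᵀ * M).trace := by
  simp only [frobSq, trace, diag_apply, mul_apply, transpose_apply, ← sq]
  exact Finset.sum_comm

theorem frobSq_add {m n : ℕ} (A B : Matrix (Fin m) (Fin n) ℝ) :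
    frobSq (A + B) = frobSq A + 2 * (Aᵀ * B).trace + frobSq B := by
  have h : (Bᵀ * A).trace = (Aᵀ * B).trace := by
    rw [← trace_transpose, transpose_mul, transpose_transpose]
  simp only [frobSq_eq_trace, transpose_add, Matrix.add_mul, Matrix.mul_add, trace_add, h]
  ring

/-- A stationary point of the EDSC objective is a global minimizer. -/
theorem edsc_le_of_stationary {dX N : ℕ} (X : Matrix (Fin dX) (Fin N) ℝ) {lam : ℝ}
    (hlam : 0 ≤ lam) {C₀ : Matrix (Fin N) (Fin N) ℝ}
    (h : C₀ = lam • (Xᵀ * (X - X * C₀))) (C : Matrix (Fin N) (Fin N) ℝ) :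
    edsc X lam C₀ ≤ edsc X lam C := by
  obtain ⟨E, rfl⟩ : ∃ E, C = C₀ + E := ⟨C - C₀, by abel⟩
  have hX : X - X * (C₀ + E) = (X - X * C₀) + X * (-E) := by
    rw [Matrix.mul_add, Matrix.mul_neg]; abel
  have htr : (C₀ᵀ * E).trace = -(lam * ((X - X * C₀)ᵀ * (X * (-E))).trace) := by
    conv_lhs => rw [h]
    rw [transpose_smul, transpose_mul, transpose_transpose, Matrix.smul_mul, trace_smul,
      smul_eq_mul, Matrix.mul_neg, Matrix.mul_neg, trace_neg, Matrix.mul_assoc]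
    ring
  have hE := frobSq_nonneg E
  have hXE := mul_nonneg hlam (frobSq_nonneg (X * (-E)))
  simp only [edsc]
  rw [hX, frobSq_add, frobSq_add, htr]
  linarith

/-- Theorem 1 (attainment of the global minimum): with `d_H ≥ r = rank X`,
`W* = R D Uᵀ` is a global minimizer of the siamese objective. -/
theorem siamese_global_min {dX N dH r : ℕ}
    (X : Matrix (Fin dX) (Fin N) ℝ) (lam : ℝ) (hlam : 0 < lam)
    (U : Matrix (Fin dX) (Fin r) ℝ) (V : Matrix (Fin N) (Fin r) ℝ)
    (σ : Fin r → ℝ) (hσ : ∀ i, 0 < σ i)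
    (hU : Uᵀ * U = 1) (hV : Vᵀ * V = 1)
    (hX : X = U * Matrix.diagonal σ * Vᵀ)
    (hrank : X.rank = r) (hdH : r ≤ dH)
    (D : Matrix (Fin r) (Fin r) ℝ)
    (hD : D = Matrix.diagonal fun i =>
      Real.sqrt (lam * (1 - lam * (((σ i) ^ 2)⁻¹ + lam)⁻¹)))
    (R : Matrix (Fin dH) (Fin r) ℝ) (hR : Rᵀ * R = 1) :
    ∀ W : Matrix (Fin dH) (Fin dX) ℝ, siam X lam (R * D * Uᵀ) ≤ siam X lam W := by
  intro W
  refine edsc_le_of_stationary X hlam.le ?_ _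
  have hUX : Uᵀ * X = diagonal σ * Vᵀ := by
    rw [hX, Matrix.mul_assoc U, ← Matrix.mul_assoc Uᵀ, hU, Matrix.one_mul]
  have hXU : Xᵀ * U = V * diagonal σ := by
    simpa using congrArg transpose hUX
  have hXX : Xᵀ * X = V * diagonal (fun i => σ i * σ i) * Vᵀ := by
    calc Xᵀ * X = Xᵀ * U * diagonal σ * Vᵀ := by
          rw [Matrix.mul_assoc, Matrix.mul_assoc, ← Matrix.mul_assoc U, ← hX]
      _ = _ := by rw [hXU, Matrix.mul_assoc V, diagonal_mul_diagonal]
  set d : Fin r → ℝ := fun i => Real.sqrt (lam * (1 - lam * (((σ i) ^ 2)⁻¹ + lam)⁻¹)) with hd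
  have hQ : Xᵀ * (R * D * Uᵀ)ᵀ * (R * D * Uᵀ) * X
      = V * diagonal (fun i => σ i * d i * d i * σ i) * Vᵀ := by
    calc Xᵀ * (R * D * Uᵀ)ᵀ * (R * D * Uᵀ) * X
        = (Xᵀ * U) * Dᵀ * (Rᵀ * R) * D * (Uᵀ * X) := by
          simp only [transpose_mul, transpose_transpose, Matrix.mul_assoc]
      _ = V * (diagonal σ * diagonal d * diagonal d * diagonal σ) * Vᵀ := by
          rw [hXU, hUX, hR, hD, diagonal_transpose]
          simp only [Matrix.mul_assoc, Matrix.one_mul]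
      _ = _ := by simp only [diagonal_mul_diagonal]
  rw [hQ, Matrix.mul_sub, ← Matrix.mul_assoc, hXX]
  have hVV (a b : Fin r → ℝ) : V * diagonal a * Vᵀ * (V * diagonal b * Vᵀ)
      = V * diagonal (fun i => a i * b i) * Vᵀ := by
    calc _ = V * diagonal a * (Vᵀ * V) * diagonal b * Vᵀ := by simp only [Matrix.mul_assoc]
      _ = _ := by rw [hV, Matrix.mul_one, Matrix.mul_assoc V, diagonal_mul_diagonal]
  rw [hVV, ← Matrix.sub_mul, ← Matrix.mul_sub, diagonal_sub, ← Matrix.smul_mul,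
    ← Matrix.mul_smul, ← diagonal_smul]
  congr 3
  ext i
  have hs := hσ i
  have hval : lam * (1 - lam * (((σ i) ^ 2)⁻¹ + lam)⁻¹) = lam / (1 + lam * σ i ^ 2) := by
    have : 1 + lam * σ i ^ 2 ≠ 0 := by positivity
    field_simp
    ring
  have hdd : d i * d i = lam / (1 + lam * σ i ^ 2) := by
    rw [hd, ← hval]
    exact Real.mul_self_sqrt (hval ▸ by positivity)
  have hq : σ i * d i * d i * σ i = lam / (1 + lam * σ i ^ 2) * σ i ^ 2 := by
    rw [← hdd]; ring
  simp only [Pi.smul_apply, smul_eq_mul, hq]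
  have : 1 + lam * σ i ^ 2 ≠ 0 := by positivity
  field_simp
  ring
end

section
/- Theorem 1 (identification of the optimal coefficient matrix). Assume d_H ≥ r = rank(X). Let D ∈ ℝ^{r×r} be the diagonal matrix with entries D_ii = sqrt(λ(1 − λ(σ_i^{−2} + λ)^{−1})), let R ∈ ℝ^{d_H×r} satisfy RᵀR = I_r, and set W* = R D Uᵀ. Then the coefficient matrix produced by W* equals the closed-form EDSC minimizer: Xᵀ(W*)ᵀW*X = λ(I_N + λXᵀX)⁻¹XᵀX. -/
open Matrix BigOperators

theorem isUnit_det_one_add_smul_transpose_mul_self {m n : Type*} [Fintype m] [Fintype n]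
    [DecidableEq n] (X : Matrix m n ℝ) {c : ℝ} (hc : 0 ≤ c) :
    IsUnit (1 + c • (Xᵀ * X)).det := by
  have hG : (Xᵀ * X).PosSemidef := by
    simpa [Matrix.conjTranspose_eq_transpose_of_trivial] using
      Matrix.posSemidef_conjTranspose_mul_self X
  exact (Matrix.PosDef.one.add_posSemidef (hG.smul hc)).det_pos.ne'.isUnit

theorem conj_diagonal_mul_conj_diagonal {m n : Type*} [Fintype m] [Fintype n] [DecidableEq n]
    {V : Matrix m n ℝ} (hV : Vᵀ * V = 1) (a b : n → ℝ) :
    V * diagonal a * Vᵀ * (V * diagonal b * Vᵀ) = V * diagonal (fun i => a i * b i) * Vᵀ := by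
  calc V * diagonal a * Vᵀ * (V * diagonal b * Vᵀ)
      = V * (diagonal a * (Vᵀ * V) * diagonal b) * Vᵀ := by simp only [Matrix.mul_assoc]
    _ = _ := by rw [hV, Matrix.mul_one, diagonal_mul_diagonal]

/-- The diagonal entries of `D²` simplify to `c / (1 + c s²)`. -/
theorem sq_sqrt_coefficient {s c : ℝ} (hs : 0 < s) (hc : 0 < c) :
    √(c * (1 - c * ((s ^ 2)⁻¹ + c)⁻¹)) ^ 2 = c / (1 + c * s ^ 2) := by
  have h : c * (1 - c * ((s ^ 2)⁻¹ + c)⁻¹) = c / (1 + c * s ^ 2) := by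
    have h1 : 1 + c * s ^ 2 ≠ 0 := by positivity
    have h2 : (s ^ 2)⁻¹ + c = (1 + c * s ^ 2) / s ^ 2 := by field_simp
    rw [h2, inv_div]
    field_simp
    ring
  rw [h, Real.sq_sqrt (by positivity)]

/-- Theorem 1 (identification of the optimal coefficient matrix): with `d_H ≥ r = rank X`
and `W* = R D Uᵀ`, the coefficient matrix `Xᵀ(W*)ᵀW*X` equals the closed-form EDSC
minimizer `λ(I + λXᵀX)⁻¹XᵀX`. -/
theorem siamese_coefficient_matrix {dX N dH r : ℕ}
    (X : Matrix (Fin dX) (Fin N) ℝ) (lam : ℝ) (hlam : 0 < lam)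
    (U : Matrix (Fin dX) (Fin r) ℝ) (V : Matrix (Fin N) (Fin r) ℝ)
    (σ : Fin r → ℝ) (hσ : ∀ i, 0 < σ i)
    (hU : Uᵀ * U = 1) (hV : Vᵀ * V = 1)
    (hX : X = U * Matrix.diagonal σ * Vᵀ)
    (hrank : X.rank = r) (hdH : r ≤ dH)
    (D : Matrix (Fin r) (Fin r) ℝ)
    (hD : D = Matrix.diagonal fun i =>
      Real.sqrt (lam * (1 - lam * (((σ i) ^ 2)⁻¹ + lam)⁻¹)))
    (R : Matrix (Fin dH) (Fin r) ℝ) (hR : Rᵀ * R = 1)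
    (Wstar : Matrix (Fin dH) (Fin dX) ℝ) (hW : Wstar = R * D * Uᵀ) :
    Xᵀ * Wstarᵀ * Wstar * X = lam • ((1 + lam • (Xᵀ * X))⁻¹ * (Xᵀ * X)) := by
  have hdet := isUnit_det_one_add_smul_transpose_mul_self X hlam.le
  have hG : Xᵀ * X = V * diagonal (fun i => σ i ^ 2) * Vᵀ := by
    calc Xᵀ * X = V * (diagonal σ * (Uᵀ * U) * diagonal σ) * Vᵀ := by
          rw [hX]
          simp only [transpose_mul, transpose_transpose, diagonal_transpose, Matrix.mul_assoc]
      _ = _ := by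
          rw [hU, Matrix.mul_one, diagonal_mul_diagonal]
          simp only [pow_two]
  have hC : Xᵀ * Wstarᵀ * Wstar * X =
      V * diagonal (fun i => σ i ^ 2 * (lam / (1 + lam * σ i ^ 2))) * Vᵀ := by
    calc Xᵀ * Wstarᵀ * Wstar * X
        = V * (diagonal σ * (Uᵀ * U) * Dᵀ * (Rᵀ * R) * D * (Uᵀ * U) * diagonal σ) * Vᵀ := by
          rw [hX, hW]
          simp only [transpose_mul, transpose_transpose, diagonal_transpose, Matrix.mul_assoc]
      _ = _ := by
          rw [hU, hR, hD]
          simp only [Matrix.mul_one, diagonal_transpose, diagonal_mul_diagonal]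
          congr 3
          ext i
          rw [← sq_sqrt_coefficient (hσ i) hlam]
          ring
  have hmul : (1 + lam • (Xᵀ * X)) * (Xᵀ * Wstarᵀ * Wstar * X) = lam • (Xᵀ * X) := by
    rw [hC, hG, Matrix.add_mul, Matrix.one_mul, Matrix.smul_mul,
      conj_diagonal_mul_conj_diagonal hV, ← Matrix.smul_mul, ← Matrix.mul_smul,
      ← Matrix.smul_mul, ← Matrix.mul_smul, ← Matrix.add_mul, ← Matrix.mul_add,
      ← diagonal_smul, ← diagonal_smul, diagonal_add]
    congr 3
    ext i
    have h : 1 + lam * σ i ^ 2 ≠ 0 := by positivity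
    simp only [Pi.smul_apply, smul_eq_mul]
    field_simp
  have hinv := nonsing_inv_mul_cancel_left _ (Xᵀ * Wstarᵀ * Wstar * X) hdet
  rw [← Matrix.mul_smul, ← hinv, hmul]
end

section
/- The minimum value of the EDSC objective is min_{C ∈ ℝ^{N×N}} f(C) = (λ/2) Σ_{i=1}^r σ_i²/(1 + λσ_i²), where σ_1, …, σ_r are the nonzero singular values of X and r = rank(X). -/
open Matrix BigOperators

theorem frobSq_mul_of_transpose_mul_self {m n r : ℕ} {U : Matrix (Fin m) (Fin r) ℝ}
    (hU : Uᵀ * U = 1) (M : Matrix (Fin r) (Fin n) ℝ) : frobSq (U * M) = frobSq M := by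
  rw [frobSq_eq_trace, frobSq_eq_trace, transpose_mul, Matrix.mul_assoc, ← Matrix.mul_assoc Uᵀ,
    hU, Matrix.one_mul]

/-- Pythagoras for the orthogonal projection `V * Vᵀ`. -/
theorem frobSq_eq_add_of_transpose_mul_self {m n r : ℕ} {V : Matrix (Fin m) (Fin r) ℝ}
    (hV : Vᵀ * V = 1) (C : Matrix (Fin m) (Fin n) ℝ) :
    frobSq C = frobSq (C - V * (Vᵀ * C)) + frobSq (Vᵀ * C) := by
  have h : (C - V * (Vᵀ * C))ᵀ * (C - V * (Vᵀ * C)) = Cᵀ * C - (Vᵀ * C)ᵀ * (Vᵀ * C) := by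
    have h' : Vᵀ * (V * (Vᵀ * C)) = Vᵀ * C := by
      rw [← Matrix.mul_assoc, hV, Matrix.one_mul]
    simp only [transpose_sub, transpose_mul, transpose_transpose, Matrix.sub_mul,
      Matrix.mul_sub, Matrix.mul_assoc, h']
    abel
  rw [frobSq_eq_trace C, frobSq_eq_trace (C - _), frobSq_eq_trace (Vᵀ * C), h, trace_sub]
  ring

/-- The EDSC objective as its minimum value plus a sum of squares. -/
theorem edsc_eq_sum_sq_add {dX N r : ℕ} {lam : ℝ} (hlam : 0 < lam)
    {U : Matrix (Fin dX) (Fin r) ℝ} {V : Matrix (Fin N) (Fin r) ℝ} (σ : Fin r → ℝ)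
    (hU : Uᵀ * U = 1) (hV : Vᵀ * V = 1) (C : Matrix (Fin N) (Fin N) ℝ) :
    edsc (U * diagonal σ * Vᵀ) lam C =
      (1 / 2) * frobSq (C - V * (Vᵀ * C)) +
        ∑ i, ∑ j, (1 + lam * σ i ^ 2) / 2 *
          ((Vᵀ * C) i j - lam * σ i ^ 2 / (1 + lam * σ i ^ 2) * V j i) ^ 2 +
        (lam / 2) * ∑ i, σ i ^ 2 / (1 + lam * σ i ^ 2) := by
  have hcol (i : Fin r) : ∑ j, V j i ^ 2 = 1 := by
    have := congrFun (congrFun hV i) i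
    simpa [mul_apply, sq] using this
  have hres : U * diagonal σ * Vᵀ - U * diagonal σ * Vᵀ * C =
      U * (diagonal σ * (Vᵀ - Vᵀ * C)) := by
    simp only [Matrix.mul_sub, Matrix.mul_assoc]
  rw [edsc, hres, frobSq_mul_of_transpose_mul_self hU, frobSq_eq_add_of_transpose_mul_self hV C,
    mul_add, add_assoc, add_assoc]
  congr 1
  simp only [frobSq, Finset.mul_sum, ← Finset.sum_add_distrib]
  refine Finset.sum_congr rfl fun i _ => ?_
  have hpos : 1 + lam * σ i ^ 2 ≠ 0 := by positivity
  have hconst : lam / 2 * (σ i ^ 2 / (1 + lam * σ i ^ 2)) =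
      ∑ j, lam / 2 * (σ i ^ 2 / (1 + lam * σ i ^ 2)) * V j i ^ 2 := by
    rw [← Finset.mul_sum, hcol, mul_one]
  rw [hconst, ← Finset.sum_add_distrib]
  refine Finset.sum_congr rfl fun j _ => ?_
  rw [diagonal_mul, Matrix.sub_apply, transpose_apply]
  field_simp
  ring

/-- The minimum value of the EDSC objective is `(λ/2) ∑ᵢ σᵢ²/(1+λσᵢ²)`, where
`σ₁,…,σ_r` are the nonzero singular values of `X` and `r = rank X`. -/
theorem edsc_min_value {dX N r : ℕ}
    (X : Matrix (Fin dX) (Fin N) ℝ) (lam : ℝ) (hlam : 0 < lam)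
    (U : Matrix (Fin dX) (Fin r) ℝ) (V : Matrix (Fin N) (Fin r) ℝ)
    (σ : Fin r → ℝ) (hσ : ∀ i, 0 < σ i)
    (hU : Uᵀ * U = 1) (hV : Vᵀ * V = 1)
    (hX : X = U * Matrix.diagonal σ * Vᵀ)
    (hrank : X.rank = r) :
    IsLeast (Set.range (edsc X lam))
      ((lam / 2) * ∑ i, (σ i) ^ 2 / (1 + lam * (σ i) ^ 2)) := by
  subst hX
  constructor
  · let D : Matrix (Fin r) (Fin r) ℝ :=
      diagonal fun i => lam * σ i ^ 2 / (1 + lam * σ i ^ 2)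
    refine ⟨V * (D * Vᵀ), ?_⟩
    have hB : Vᵀ * (V * (D * Vᵀ)) = D * Vᵀ := by
      rw [← Matrix.mul_assoc, hV, Matrix.one_mul]
    rw [edsc_eq_sum_sq_add hlam σ hU hV, hB]
    simp [D, frobSq, diagonal_mul]
  · rintro _ ⟨C, rfl⟩
    rw [edsc_eq_sum_sq_add hlam σ hU hV]
    have hproj := frobSq_nonneg (C - V * (Vᵀ * C))
    refine le_add_of_nonneg_left (add_nonneg (by positivity) ?_)
    exact Finset.sum_nonneg fun i _ => Finset.sum_nonneg fun j _ => by positivity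
end

section
/- If d_H ≥ rank(X), then there exists a matrix W ∈ ℝ^{d_H×d_X} such that XᵀWᵀWX = C*, where C* = λ(I_N + λXᵀX)⁻¹XᵀX is the EDSC minimizer; i.e., the optimal EDSC coefficient matrix is realizable as the Gram matrix of linear embeddings H = WX of dimension d_H. -/
open Matrix BigOperators

/-- A subspace of Euclidean space of dimension at most `d` embeds isometrically into `ℝ^d` by a
matrix. -/
theorem exists_matrix_dotProduct_mulVec_eq {ι : Type*} [Fintype ι] {d : ℕ}
    (S : Submodule ℝ (EuclideanSpace ℝ ι)) (hS : Module.finrank ℝ S ≤ d) :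
    ∃ V : Matrix (Fin d) ι ℝ, ∀ y ∈ S, ∀ z ∈ S,
      (V *ᵥ y.ofLp) ⬝ᵥ (V *ᵥ z.ofLp) = y.ofLp ⬝ᵥ z.ofLp := by
  obtain ⟨k, rfl⟩ := Nat.exists_eq_add_of_le hS
  let b := stdOrthonormalBasis ℝ S
  refine ⟨Matrix.of (Fin.append (fun j => (b j : EuclideanSpace ℝ ι).ofLp) 0), ?_⟩
  intro y hy z hz
  have h := b.sum_inner_mul_inner ⟨y, hy⟩ ⟨z, hz⟩
  simp only [Submodule.coe_inner, EuclideanSpace.inner_eq_star_dotProduct, star_trivial] at h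
  simp only [dotProduct_comm y.ofLp z.ofLp, ← h]
  simp only [dotProduct, Matrix.mulVec, Fin.sum_univ_add, Matrix.of_apply, Fin.append_left,
    Fin.append_right, Pi.zero_apply, zero_mul, mul_zero, Finset.sum_const_zero, add_zero]
  refine Finset.sum_congr rfl fun j _ => ?_
  congr 1
  exact Finset.sum_congr rfl fun i _ => mul_comm _ _

/-- The Gram matrix of `Y` is preserved by some linear map into any dimension `d ≥ rank Y`. -/
theorem exists_matrix_gram_mul_eq {m n d : ℕ} (Y : Matrix (Fin m) (Fin n) ℝ)
    (hY : Y.rank ≤ d) :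
    ∃ V : Matrix (Fin d) (Fin m) ℝ, (V * Y)ᵀ * (V * Y) = Yᵀ * Y := by
  obtain ⟨V, hV⟩ := exists_matrix_dotProduct_mulVec_eq
    (Submodule.span ℝ (Set.range fun j => WithLp.toLp 2 (Y.col j))) (d := d) (by
      refine le_trans (le_of_eq ?_) hY
      rw [Matrix.rank_eq_finrank_span_cols,
        ← LinearEquiv.finrank_map_eq (WithLp.linearEquiv 2 ℝ (Fin m → ℝ)),
        Submodule.map_span, ← Set.range_comp]
      rfl)
  refine ⟨V, ?_⟩
  ext i j
  exact hV _ (Submodule.subset_span ⟨i, rfl⟩) _ (Submodule.subset_span ⟨j, rfl⟩)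

/-- The push-through identity for the regularized inverse. -/
theorem one_add_smul_inv_mul_transpose {m n : ℕ} (X : Matrix (Fin m) (Fin n) ℝ) {c : ℝ}
    (hl : IsUnit (1 + c • (Xᵀ * X)).det) (hr : IsUnit (1 + c • (X * Xᵀ)).det) :
    (1 + c • (Xᵀ * X))⁻¹ * Xᵀ = Xᵀ * (1 + c • (X * Xᵀ))⁻¹ := by
  have h : Xᵀ * (1 + c • (X * Xᵀ)) = (1 + c • (Xᵀ * X)) * Xᵀ := by
    simp [Matrix.mul_add, Matrix.add_mul, Matrix.mul_assoc]
  calc (1 + c • (Xᵀ * X))⁻¹ * Xᵀ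
      = (1 + c • (Xᵀ * X))⁻¹ * (Xᵀ * (1 + c • (X * Xᵀ))) * (1 + c • (X * Xᵀ))⁻¹ := by
        rw [← Matrix.mul_assoc, Matrix.mul_nonsing_inv_cancel_right _ _ hr]
    _ = Xᵀ * (1 + c • (X * Xᵀ))⁻¹ := by
        rw [h, Matrix.nonsing_inv_mul_cancel_left _ _ hl]

theorem posDef_one_add_smul_transpose_mul_self {m n : ℕ} (X : Matrix (Fin m) (Fin n) ℝ) {c : ℝ}
    (hc : 0 ≤ c) : (1 + c • (Xᵀ * X)).PosDef :=
  Matrix.PosDef.one.add_posSemidef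
    ((by simpa using Matrix.posSemidef_conjTranspose_mul_self X :
      (Xᵀ * X).PosSemidef).smul hc)

open scoped MatrixOrder Matrix.Norms.L2Operator in
theorem exists_eq_transpose_mul_self_of_posSemidef {n : ℕ} {A : Matrix (Fin n) (Fin n) ℝ}
    (hA : A.PosSemidef) : ∃ B : Matrix (Fin n) (Fin n) ℝ, A = Bᵀ * B := by
  obtain ⟨B, hB⟩ := CStarAlgebra.nonneg_iff_eq_star_mul_self.mp hA.nonneg
  exact ⟨B, by rwa [star_eq_conjTranspose, conjTranspose_eq_transpose_of_trivial] at hB⟩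

/-- If `d_H ≥ rank X`, the optimal EDSC coefficient matrix
`C* = λ(I + λXᵀX)⁻¹XᵀX` is realizable as the Gram matrix `XᵀWᵀWX` of linear
embeddings `H = WX` of dimension `d_H`. -/
theorem edsc_minimizer_realizable {dX N dH : ℕ}
    (X : Matrix (Fin dX) (Fin N) ℝ) (lam : ℝ) (hlam : 0 < lam)
    (hdH : X.rank ≤ dH) :
    ∃ W : Matrix (Fin dH) (Fin dX) ℝ,
      Xᵀ * Wᵀ * W * X = lam • ((1 + lam • (Xᵀ * X))⁻¹ * (Xᵀ * X)) := by
  have hl := posDef_one_add_smul_transpose_mul_self X hlam.le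
  have hr := posDef_one_add_smul_transpose_mul_self Xᵀ hlam.le
  rw [transpose_transpose] at hr
  obtain ⟨B, hB⟩ := exists_eq_transpose_mul_self_of_posSemidef
    (hr.inv.posSemidef.smul hlam.le)
  obtain ⟨V, hV⟩ := exists_matrix_gram_mul_eq (B * X) ((Matrix.rank_mul_le_right B X).trans hdH)
  refine ⟨V * B, ?_⟩
  calc Xᵀ * (V * B)ᵀ * (V * B) * X = (V * (B * X))ᵀ * (V * (B * X)) := by
        simp only [transpose_mul, Matrix.mul_assoc]
    _ = Xᵀ * (Bᵀ * B) * X := by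
        rw [hV]; simp only [transpose_mul, Matrix.mul_assoc]
    _ = lam • ((1 + lam • (Xᵀ * X))⁻¹ * (Xᵀ * X)) := by
        rw [← hB, ← Matrix.mul_assoc _ Xᵀ X, one_add_smul_inv_mul_transpose X
          hl.det_pos.ne'.isUnit hr.det_pos.ne'.isUnit]
        simp
end

section
/- Subspace-preserving property in the noise-free setting: suppose the subspaces S_1, …, S_K are independent. If C ∈ ℝ^{N×N} minimizes the Frobenius norm ‖C‖_F subject to the self-expression constraint X = XC, then C_{ij} = 0 whenever g(i) ≠ g(j); i.e., the minimal-norm solution is subspace-preserving (block-diagonal up to a permutation of the columns grouping points of the same subspace together). -/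
open Matrix BigOperators

/-- Frobenius norm of a real matrix. -/
noncomputable def frobNorm {m n : ℕ} (M : Matrix (Fin m) (Fin n) ℝ) : ℝ :=
  Real.sqrt (∑ i, ∑ j, (M i j) ^ 2)

/-- A finite family of subspaces whose dimensions add up to that of their sum is independent: a
vanishing sum of vectors, one from each subspace, has vanishing terms. -/
theorem eq_zero_of_sum_eq_zero_of_finrank_iSup {F V ι : Type*} [Field F] [AddCommGroup V]
    [Module F V] [FiniteDimensional F V] [Fintype ι] (S : ι → Submodule F V)
    (h : Module.finrank F ↥(⨆ k, S k) = ∑ k, Module.finrank F ↥(S k))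
    (v : ι → V) (hv : ∀ k, v k ∈ S k) (hsum : ∑ k, v k = 0) (k : ι) : v k = 0 := by
  classical
  let f : (∀ k, S k) →ₗ[F] V := LinearMap.lsum F (fun k => S k) F fun k => (S k).subtype
  have hf : ∀ w, f w = ∑ k, (w k : V) := fun w => by simp [f, LinearMap.lsum_apply]
  have hle : (⨆ k, S k) ≤ LinearMap.range f := by
    refine iSup_le fun k x hx => ⟨Pi.single k ⟨x, hx⟩, ?_⟩
    rw [hf, Finset.sum_eq_single k (fun j _ hj => by simp [Pi.single_eq_of_ne hj]) (by simp)]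
    simp
  have hrank := f.finrank_range_add_finrank_ker
  have hmono := Submodule.finrank_mono hle
  rw [Module.finrank_pi_fintype] at hrank
  have hker : LinearMap.ker f = ⊥ := Submodule.finrank_eq_zero.mp (by omega)
  have hw : (fun k => (⟨v k, hv k⟩ : S k)) ∈ LinearMap.ker f := by
    rw [LinearMap.mem_ker, hf]
    exact hsum
  rw [hker, Submodule.mem_bot] at hw
  exact congrArg Subtype.val (congrFun hw k)

/-- Dropping the coefficients between different groups keeps a self-expression of vectors taken
from independent subspaces. -/
theorem eq_mul_mask_of_eq_mul {m n ι : Type*} [Fintype m] [Fintype n] [Fintype ι]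
    [DecidableEq ι] (X : Matrix m n ℝ) (lab : n → ι) (S : ι → Submodule ℝ (m → ℝ))
    (hmem : ∀ i, Xᵀ i ∈ S (lab i))
    (hindep : Module.finrank ℝ ↥(⨆ k, S k) = ∑ k, Module.finrank ℝ ↥(S k))
    (C : Matrix n n ℝ) (hfeas : X = X * C) :
    X = X * Matrix.of fun i j => if lab i = lab j then C i j else 0 := by
  ext a j
  let v : ι → m → ℝ := fun k =>
    (∑ i, if lab i = k then C i j • Xᵀ i else 0) - if lab j = k then Xᵀ j else 0
  have hv : ∀ k, v k ∈ S k := fun k => by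
    refine sub_mem (sum_mem fun i _ => ?_) ?_
    · split_ifs with h
      · exact h ▸ (S (lab i)).smul_mem _ (hmem i)
      · exact zero_mem _
    · split_ifs with h
      · exact h ▸ hmem j
      · exact zero_mem _
  have hsum : ∑ k, v k = 0 := by
    simp only [v, Finset.sum_sub_distrib]
    rw [Finset.sum_comm]
    simp only [Finset.sum_ite_eq, Finset.mem_univ, if_true]
    rw [sub_eq_zero]
    ext b
    have hb := congrFun (congrFun hfeas b) j
    rw [Matrix.mul_apply] at hb
    simp only [Finset.sum_apply, Pi.smul_apply, smul_eq_mul, Matrix.transpose_apply]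
    rw [hb]
    exact Finset.sum_congr rfl fun i _ => mul_comm _ _
  have h0 := congrFun (eq_zero_of_sum_eq_zero_of_finrank_iSup S hindep v hv hsum (lab j)) a
  simp only [v, if_true, Pi.sub_apply, Finset.sum_apply, Matrix.transpose_apply,
    Pi.zero_apply, sub_eq_zero] at h0
  rw [Matrix.mul_apply, ← h0]
  refine Finset.sum_congr rfl fun i _ => ?_
  by_cases h : lab i = lab j <;> simp [h, mul_comm]

/-- Subspace-preserving property in the noise-free setting: if the subspaces
`S₁, …, S_K` are independent (the dimension of their sum equals the sum of their
dimensions), each column `xᵢ` of `X` lies in `S_{g(i)}`, and `C` minimizes the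
Frobenius norm subject to `X = XC`, then `C i j = 0` whenever `g i ≠ g j`. -/
theorem minimal_norm_solution_subspace_preserving {dX N K : ℕ}
    (X : Matrix (Fin dX) (Fin N) ℝ)
    (lab : Fin N → Fin K)
    (S : Fin K → Submodule ℝ (Fin dX → ℝ))
    (hmem : ∀ i : Fin N, Xᵀ i ∈ S (lab i))
    (hindep : Module.finrank ℝ ↥(⨆ k, S k) = ∑ k, Module.finrank ℝ ↥(S k))
    (C : Matrix (Fin N) (Fin N) ℝ)
    (hfeas : X = X * C)
    (hmin : ∀ C' : Matrix (Fin N) (Fin N) ℝ, X = X * C' → frobNorm C ≤ frobNorm C') :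
    ∀ i j : Fin N, lab i ≠ lab j → C i j = 0 := by
  intro i j hij
  have hle := hmin _ (eq_mul_mask_of_eq_mul X lab S hmem hindep C hfeas)
  unfold frobNorm at hle
  rw [Real.sqrt_le_sqrt_iff (by positivity)] at hle
  simp only [Matrix.of_apply] at hle
  by_contra hC
  refine absurd hle (not_le.mpr ?_)
  have hentry : ∀ a b, (if lab a = lab b then C a b else 0) ^ 2 ≤ C a b ^ 2 := fun a b => by
    split_ifs
    · exact le_rfl
    · simpa using sq_nonneg (C a b)
  refine Finset.sum_lt_sum (fun a _ => Finset.sum_le_sum fun b _ => hentry a b)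
    ⟨i, Finset.mem_univ i, Finset.sum_lt_sum (fun b _ => hentry i b) ⟨j, Finset.mem_univ j, ?_⟩⟩
  simpa [hij] using pow_pos (abs_pos.mpr hC) 2
end

section
/- Block-diagonal feasibility lemma: suppose the subspaces S_1, …, S_K are independent and C ∈ ℝ^{N×N} satisfies X = XC. Define the block-diagonal restriction C^B by (C^B)_{ij} = C_{ij} if g(i) = g(j) and (C^B)_{ij} = 0 otherwise. Then X = XC^B and ‖C^B‖_F ≤ ‖C‖_F, with strict inequality unless C = C^B. -/
open Matrix BigOperators

/-- Vectors chosen from subspaces whose dimensions add up to the dimension of their sum vanish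
as soon as they sum to zero. -/
theorem Submodule.eq_zero_of_sum_eq_zero_of_finrank_iSup_eq {𝕜 V ι : Type*} [Field 𝕜]
    [AddCommGroup V] [Module 𝕜 V] [FiniteDimensional 𝕜 V] [Fintype ι] (S : ι → Submodule 𝕜 V)
    (hS : Module.finrank 𝕜 ↥(⨆ k, S k) = ∑ k, Module.finrank 𝕜 ↥(S k))
    (w : ι → V) (hw : ∀ k, w k ∈ S k) (hsum : ∑ k, w k = 0) (k : ι) : w k = 0 := by
  classical
  let f : (∀ k, S k) →ₗ[𝕜] V := ∑ k, (S k).subtype ∘ₗ LinearMap.proj k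
  have hf (v : ∀ k, S k) : f v = ∑ k, (v k : V) := by simp [f]
  have hle : (⨆ k, S k) ≤ LinearMap.range f := by
    refine iSup_le fun k x hx => ⟨Pi.single k ⟨x, hx⟩, ?_⟩
    rw [hf, Finset.sum_eq_single k]
    · simp
    · intro l _ hl
      simp [Pi.single_eq_of_ne hl]
    · simp
  have hrank := f.finrank_range_add_finrank_ker
  rw [Module.finrank_pi_fintype, ← hS] at hrank
  have hmono := Submodule.finrank_mono hle
  have hker : LinearMap.ker f = ⊥ := Submodule.finrank_eq_zero.mp (by omega)
  have hzero : (fun k => ⟨w k, hw k⟩ : ∀ k, S k) ∈ LinearMap.ker f := by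
    rw [LinearMap.mem_ker, hf]
    exact hsum
  rw [hker, Submodule.mem_bot] at hzero
  exact congrArg Subtype.val (congrFun hzero k)

theorem frobNorm_le_of_sq_le {m n : ℕ} {A B : Matrix (Fin m) (Fin n) ℝ}
    (h : ∀ i j, A i j ^ 2 ≤ B i j ^ 2) : frobNorm A ≤ frobNorm B :=
  Real.sqrt_le_sqrt (Finset.sum_le_sum fun i _ => Finset.sum_le_sum fun j _ => h i j)

theorem frobNorm_lt_of_sq_le_of_sq_lt {m n : ℕ} {A B : Matrix (Fin m) (Fin n) ℝ}
    (h : ∀ i j, A i j ^ 2 ≤ B i j ^ 2) {i : Fin m} {j : Fin n} (hlt : A i j ^ 2 < B i j ^ 2) :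
    frobNorm A < frobNorm B :=
  Real.sqrt_lt_sqrt (by positivity) <|
    Finset.sum_lt_sum (fun i _ => Finset.sum_le_sum fun j _ => h i j)
      ⟨i, Finset.mem_univ i,
        Finset.sum_lt_sum (fun j _ => h i j) ⟨j, Finset.mem_univ j, hlt⟩⟩

/-- Block-diagonal feasibility lemma: if the subspaces `S₁, …, S_K` are independent
(the dimension of their sum equals the sum of their dimensions), each column `xᵢ` of
`X` lies in `S_{g(i)}` and `X = XC`, then the block-diagonal restriction `C^B` of `C`
satisfies `X = XC^B` and `‖C^B‖_F ≤ ‖C‖_F`, with strict inequality unless `C = C^B`. -/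
theorem block_diagonal_feasibility {dX N K : ℕ}
    (X : Matrix (Fin dX) (Fin N) ℝ)
    (lab : Fin N → Fin K)
    (S : Fin K → Submodule ℝ (Fin dX → ℝ))
    (hmem : ∀ i : Fin N, Xᵀ i ∈ S (lab i))
    (hindep : Module.finrank ℝ ↥(⨆ k, S k) = ∑ k, Module.finrank ℝ ↥(S k))
    (C : Matrix (Fin N) (Fin N) ℝ)
    (hfeas : X = X * C)
    (CB : Matrix (Fin N) (Fin N) ℝ)
    (hCB : CB = fun i j => if lab i = lab j then C i j else 0) :
    X = X * CB ∧ frobNorm CB ≤ frobNorm C ∧ (C ≠ CB → frobNorm CB < frobNorm C) := by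
  subst hCB
  have hsq (i j : Fin N) : (if lab i = lab j then C i j else 0) ^ 2 ≤ C i j ^ 2 := by
    split_ifs
    · exact le_rfl
    · simpa using sq_nonneg (C i j)
  refine ⟨?_, frobNorm_le_of_sq_le hsq, fun hne => ?_⟩
  · ext a j
    have hcol : Xᵀ j = ∑ i, C i j • Xᵀ i := by
      ext b
      have hb := congrFun (congrFun hfeas b) j
      rw [Matrix.mul_apply] at hb
      simpa [Finset.sum_apply, mul_comm] using hb
    have hzero := Submodule.eq_zero_of_sum_eq_zero_of_finrank_iSup_eq S hindep
      (fun k => (∑ i, if lab i = k then C i j • Xᵀ i else 0) - if lab j = k then Xᵀ j else 0)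
      (fun k => by
        refine Submodule.sub_mem _ (Submodule.sum_mem _ fun i _ => ?_) ?_
        · split_ifs with h
          · exact h ▸ Submodule.smul_mem _ _ (hmem i)
          · exact Submodule.zero_mem _
        · split_ifs with h
          · exact h ▸ hmem j
          · exact Submodule.zero_mem _)
      (by
        rw [Finset.sum_sub_distrib, Finset.sum_comm]
        simp only [Finset.sum_ite_eq, Finset.mem_univ, if_true]
        rw [← hcol, sub_self])
      (lab j)
    have ha := congrFun (sub_eq_zero.mp hzero) a
    simp only [if_true, Finset.sum_apply] at ha
    refine ha.symm.trans (Eq.trans (Finset.sum_congr rfl fun i _ => ?_) Matrix.mul_apply.symm)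
    split_ifs <;> simp [mul_comm]
  · obtain ⟨i, j, hij⟩ : ∃ i j, C i j ≠ if lab i = lab j then C i j else 0 := by
      by_contra! h
      exact hne (Matrix.ext h)
    refine frobNorm_lt_of_sq_le_of_sq_lt hsq (i := i) (j := j) ?_
    split_ifs at hij ⊢ with h
    · exact absurd rfl hij
    · simpa using sq_pos_of_ne_zero hij
end

section
/- Orthogonal clusters yield orthogonal embeddings: suppose columns of X from different groups are orthogonal, i.e., x_iᵀx_j = 0 whenever g(i) ≠ g(j). Then the EDSC minimizer C* = λ(I_N + λXᵀX)⁻¹XᵀX satisfies C*_{ij} = 0 whenever g(i) ≠ g(j). Consequently, for any W ∈ ℝ^{d_H×d_X} with XᵀWᵀWX = C*, the embeddings h_i = Wx_i and h_j = Wx_j of points from different groups are orthogonal: h_iᵀh_j = 0. -/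
open Matrix BigOperators

/-- A matrix commutes with `diagonal d` iff it vanishes at every pair of indices which `d`
separates. -/
theorem Matrix.commute_diagonal_iff {n R : Type*} [Fintype n] [DecidableEq n] [CommRing R]
    [NoZeroDivisors R] (d : n → R) (M : Matrix n n R) :
    Commute (diagonal d) M ↔ ∀ i j, d i ≠ d j → M i j = 0 := by
  rw [commute_iff_eq, ← Matrix.ext_iff]
  refine forall₂_congr fun i j => ?_
  rw [diagonal_mul, mul_diagonal, mul_comm (M i j), mul_eq_mul_right_iff]
  tauto

/-- Orthogonal clusters yield orthogonal embeddings: if columns of `X` from different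
groups are orthogonal, then the EDSC minimizer `C* = λ(I + λXᵀX)⁻¹XᵀX` satisfies
`C* i j = 0` whenever `g i ≠ g j`, and for any `W` with `XᵀWᵀWX = C*` the embeddings
`hᵢ = Wxᵢ` of points from different groups are orthogonal. -/
theorem orthogonal_clusters_orthogonal_embeddings {dX N K : ℕ}
    (X : Matrix (Fin dX) (Fin N) ℝ) (lam : ℝ) (hlam : 0 < lam)
    (lab : Fin N → Fin K)
    (horth : ∀ i j : Fin N, lab i ≠ lab j → Xᵀ i ⬝ᵥ Xᵀ j = 0)
    (Cstar : Matrix (Fin N) (Fin N) ℝ)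
    (hC : Cstar = lam • ((1 + lam • (Xᵀ * X))⁻¹ * (Xᵀ * X))) :
    (∀ i j : Fin N, lab i ≠ lab j → Cstar i j = 0) ∧
    (∀ (dH : ℕ) (W : Matrix (Fin dH) (Fin dX) ℝ),
      Xᵀ * Wᵀ * W * X = Cstar →
      ∀ i j : Fin N, lab i ≠ lab j → (W *ᵥ Xᵀ i) ⬝ᵥ (W *ᵥ Xᵀ j) = 0) := by
  have hd (i j : Fin N) : ((lab i : ℕ) : ℝ) ≠ ((lab j : ℕ) : ℝ) ↔ lab i ≠ lab j := by
    simp [Fin.val_inj]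
  have hG : Commute (diagonal fun i => ((lab i : ℕ) : ℝ)) (Xᵀ * X) :=
    (commute_diagonal_iff _ _).2 fun i j hij => horth i j ((hd i j).1 hij)
  have hinv : Commute (diagonal fun i => ((lab i : ℕ) : ℝ)) (1 + lam • (Xᵀ * X))⁻¹ := by
    simpa only [Matrix.zpow_neg_one] using
      Matrix.Commute.zpow_right ((Commute.one_right _).add_right (hG.smul_right lam)) (-1)
  have hzero : ∀ i j : Fin N, lab i ≠ lab j → Cstar i j = 0 := fun i j hij =>
    (commute_diagonal_iff _ _).1 (hC ▸ (hinv.mul_right hG).smul_right lam) i j ((hd i j).2 hij)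
  refine ⟨hzero, fun dH W hW i j hij => ?_⟩
  have hgram : Xᵀ * Wᵀ * W * X = (W * X)ᵀ * (W * X) := by
    rw [transpose_mul]
    simp only [Matrix.mul_assoc]
  rw [← hzero i j hij, ← hW, hgram]
  rfl
end
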